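/- arXiv:2507.15324 — 4 statements merged into one kernel-verified Lean document; each statement's English description precedes it below -/
import Mathlib

section
/- Let a < b be real numbers, φ₀ ∈ ℝ, let P : ℝ → ℝ be integrable on [a,b] and odd on [a,b], and let W : ℝ → ℝ be any function. Define φ(t) = φ₀ + ∫ₐᵗ P(s) ds and I(t) = W(φ(t)) P(t) for t ∈ [a,b]. Then I is odd on [a,b]. -/
/-- A function `h : ℝ → ℝ` is *odd on the interval* `[a,b]` if
`h x = -h (a + b - x)` for all `x ∈ [a,b]`. -/
def OddOnI (h : ℝ → ℝ) (a b : ℝ) : Prop :=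
  ∀ x ∈ Set.Icc a b, h x = -h (a + b - x)

/-- if `P` is integrable and odd on `[a,b]`, `W : ℝ → ℝ` arbitrary,
`φ t = φ₀ + ∫ₐᵗ P` and `I t = W (φ t) * P t`, then the memristor current `I`
is odd on `[a,b]`. -/
theorem current_odd_of_odd_voltage (a b φ₀ : ℝ) (hab : a < b) (P W : ℝ → ℝ)
    (hint : IntervalIntegrable P MeasureTheory.volume a b)
    (hodd : OddOnI P a b)
    (φ I : ℝ → ℝ)
    (hφ : ∀ t, φ t = φ₀ + ∫ s in a..t, P s)
    (hI : ∀ t, I t = W (φ t) * P t) :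
    OddOnI I a b := by
  intro x hx
  have hx1 := hx.1
  have hx2 := hx.2
  have hy : a + b - x ∈ Set.Icc a b := ⟨by linarith, by linarith⟩
  have hau : a ∈ Set.uIcc a b := Set.left_mem_uIcc
  have hxu : x ∈ Set.uIcc a b := Set.Icc_subset_uIcc hx
  have hyu : a + b - x ∈ Set.uIcc a b := Set.Icc_subset_uIcc hy
  have h1 : IntervalIntegrable P MeasureTheory.volume a x :=
    hint.mono_set (Set.uIcc_subset_uIcc hau hxu)
  have h2 : IntervalIntegrable P MeasureTheory.volume x (a + b - x) :=
    hint.mono_set (Set.uIcc_subset_uIcc hxu hyu)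
  have e1 : ∫ s in x..(a + b - x), P (a + b - s) = ∫ s in x..(a + b - x), P s := by
    rw [intervalIntegral.integral_comp_sub_left (fun s => P s) (a + b)]
    simp
  have e2 : ∫ s in x..(a + b - x), P s = ∫ s in x..(a + b - x), -P (a + b - s) := by
    apply intervalIntegral.integral_congr
    intro s hs
    apply hodd
    have := Set.uIcc_subset_uIcc hxu hyu hs
    rwa [Set.uIcc_of_le hab.le] at this
  rw [intervalIntegral.integral_neg, e1] at e2
  have e3 := intervalIntegral.integral_add_adjacent_intervals h1 h2
  have e4 : φ (a + b - x) = φ x := by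
    rw [hφ, hφ]
    linarith
  rw [hI, hI, e4, hodd x hx]
  ring
end

section
/- Let T > 0, let σ : ℝ → ℝ be odd (σ(−x) = −σ(x) for all x) and let W : ℝ → ℝ be any function. Let n, m ∈ ℕ, let S ∈ {0,1}^{n×m} be a constant switch matrix, let φ₀ ∈ ℝ^{n×m}, and let P : [0,T] → ℝ^m be continuous with each component P_j odd on [0,T/2] and odd on [T/2,T]. Define φ_{kj}(t) = φ₀_{kj} + S_{kj} ∫₀ᵗ P_j(s) ds and P̂_k(t) = σ(Σ_{j=1}^m S_{kj} W(φ_{kj}(t)) P_j(t)). Then every φ_{kj} is even on [0,T/2] and even on [T/2,T] (so φ_{kj}(0) = φ_{kj}(T/2) = φ_{kj}(T)), and every P̂_k is odd on [0,T/2] and odd on [T/2,T]. -/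
open scoped BigOperators

/-- A function `h : ℝ → ℝ` is *even on the interval* `[a,b]` if
`h x = h (a + b - x)` for all `x ∈ [a,b]`. -/
def EvenOnI (h : ℝ → ℝ) (a b : ℝ) : Prop :=
  ∀ x ∈ Set.Icc a b, h x = h (a + b - x)

theorem integral_zero_of_oddOnI (p : ℝ → ℝ) (a b : ℝ) (h : OddOnI p a b) (x : ℝ)
    (hx : x ∈ Set.Icc a b) : ∫ s in x..(a + b - x), p s = 0 := by
  have h1 : ∫ s in x..(a + b - x), p (a + b - s) = ∫ s in x..(a + b - x), p s := by
    rw [intervalIntegral.integral_comp_sub_left]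
    congr 1
    ring
  have h2 : ∫ s in x..(a + b - x), p s = ∫ s in x..(a + b - x), -p (a + b - s) := by
    apply intervalIntegral.integral_congr
    intro s hs
    have hy : a + b - x ∈ Set.Icc a b := ⟨by linarith [hx.2], by linarith [hx.1]⟩
    exact h s (Set.uIcc_subset_Icc hx hy hs)
  rw [intervalIntegral.integral_neg, h1] at h2
  linarith

/-- for a crossbar array with constant switch matrix `S ∈ {0,1}^{n×m}`,
odd activation `σ`, arbitrary memductance function `W`, and continuous column
voltages `P_j` that are odd on `[0,T/2]` and on `[T/2,T]`, the fluxes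
`φ_{kj}(t) = φ₀_{kj} + S_{kj} ∫₀ᵗ P_j` are even on `[0,T/2]` and on `[T/2,T]`
(so `φ_{kj}(0) = φ_{kj}(T/2) = φ_{kj}(T)`), and the next-layer voltages
`P̂_k(t) = σ (Σ_j S_{kj} W(φ_{kj}(t)) P_j(t))` are odd on `[0,T/2]` and on `[T/2,T]`. -/
theorem crossbar_flux_even_output_odd (T : ℝ) (hT : 0 < T)
    (σ W : ℝ → ℝ) (hσodd : ∀ x, σ (-x) = -σ x)
    (n m : ℕ) (hn : 0 < n) (hm : 0 < m)
    (S : Fin n → Fin m → ℝ) (hS : ∀ k j, S k j = 0 ∨ S k j = 1)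
    (φ₀ : Fin n → Fin m → ℝ)
    (P : Fin m → ℝ → ℝ) (hPcont : ∀ j, Continuous (P j))
    (hPodd1 : ∀ j, OddOnI (P j) 0 (T / 2))
    (hPodd2 : ∀ j, OddOnI (P j) (T / 2) T)
    (φ : Fin n → Fin m → ℝ → ℝ)
    (hφ : ∀ k j t, φ k j t = φ₀ k j + S k j * ∫ s in (0:ℝ)..t, P j s)
    (Phat : Fin n → ℝ → ℝ)
    (hPhat : ∀ k t, Phat k t = σ (∑ j, S k j * W (φ k j t) * P j t)) :
    (∀ k j, EvenOnI (φ k j) 0 (T / 2) ∧ EvenOnI (φ k j) (T / 2) T ∧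
      φ k j 0 = φ k j (T / 2) ∧ φ k j (T / 2) = φ k j T) ∧
    (∀ k, OddOnI (Phat k) 0 (T / 2) ∧ OddOnI (Phat k) (T / 2) T) := by
  have key : ∀ a b, (∀ j, OddOnI (P j) a b) → ∀ k j, EvenOnI (φ k j) a b := by
    intro a b h k j x hx
    have h0 := integral_zero_of_oddOnI (P j) a b (h j) x hx
    have h1 := intervalIntegral.integral_add_adjacent_intervals
      ((hPcont j).intervalIntegrable 0 x)
      ((hPcont j).intervalIntegrable (μ := MeasureTheory.volume) x (a + b - x))
    rw [hφ, hφ, ← h1, h0, add_zero]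
  have key2 : ∀ a b, (∀ j, OddOnI (P j) a b) → ∀ k, OddOnI (Phat k) a b := by
    intro a b h k x hx
    rw [hPhat, hPhat, ← hσodd, ← Finset.sum_neg_distrib]
    congr 1
    refine Finset.sum_congr rfl fun j _ => ?_
    rw [key a b h k j x hx, h j x hx]
    ring
  refine ⟨fun k j => ⟨key _ _ hPodd1 k j, key _ _ hPodd2 k j, ?_, ?_⟩,
    fun k => ⟨key2 _ _ hPodd1 k, key2 _ _ hPodd2 k⟩⟩
  · have := key _ _ hPodd1 k j 0 ⟨le_rfl, by linarith⟩
    simpa using this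
  · have := key _ _ hPodd2 k j (T / 2) ⟨le_rfl, by linarith⟩
    simpa using this
end

section
/- Let L ≥ 1, let n₀, …, n_L be positive integers, let σ : ℝ → ℝ be continuous and odd, let W : ℝ → ℝ be continuous, let τ > 0 and T = 4τ, let û ∈ ℝ^{n₀}, and let φ₀^ℓ ∈ ℝ^{n_ℓ × n_{ℓ−1}} for ℓ = 1, …, L. Define, for t ∈ [0,T], P⁰(t) = û·Q(t − T/2), and recursively for ℓ = 1, …, L: φ^ℓ(t)_{kj} = (φ₀^ℓ)_{kj} + ∫₀ᵗ P^{ℓ−1}_j(s) ds and P^ℓ(t)_k = σ(Σ_{j=1}^{n_{ℓ−1}} W(φ^ℓ(t)_{kj}) P^{ℓ−1}(t)_j). Then: (1) φ^ℓ(0) = φ^ℓ(T/2) = φ^ℓ(T) for every ℓ ∈ {1, …, L}; and (2) P^L(T/2) = a^L, where a⁰ = û and a^ℓ_k = σ(Σ_j W((φ₀^ℓ)_{kj}) a^{ℓ−1}_j) for ℓ = 1, …, L. That is, the circuit evaluation at the midpoint of the block input equals the output h(û) of the artificial neural network with weight matrices M̂^ℓ = W(φ₀^ℓ), and the experiment is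 non-invasive. -/
open scoped BigOperators

/-- The block signal: `Q t = 0` for `t < -2τ`, `-1` for `-2τ ≤ t < -τ`,
`1` for `-τ ≤ t ≤ τ`, `-1` for `τ < t ≤ 2τ` and `0` for `t > 2τ`. -/
noncomputable def blockSignal (τ : ℝ) (t : ℝ) : ℝ :=
  if t < -(2 * τ) then 0
  else if t < -τ then -1
  else if t ≤ τ then 1
  else if t ≤ 2 * τ then -1
  else 0

theorem blockSignal_measurable (τ : ℝ) : Measurable (blockSignal τ) := by
  unfold blockSignal
  refine Measurable.ite measurableSet_Iio measurable_const ?_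
  refine Measurable.ite measurableSet_Iio measurable_const ?_
  refine Measurable.ite measurableSet_Iic measurable_const ?_
  exact Measurable.ite measurableSet_Iic measurable_const measurable_const

theorem blockSignal_mem (τ t : ℝ) : blockSignal τ t ∈ Set.Icc (-1 : ℝ) 1 := by
  unfold blockSignal
  split_ifs <;> norm_num

/-- A continuous function of time and of the block signal is locally integrable. -/
theorem block_integrable (τ c : ℝ) (F : ℝ × ℝ → ℝ) (hF : Continuous F) (a b : ℝ) :
    IntervalIntegrable (fun t => F (t, blockSignal τ (t - c))) MeasureTheory.volume a b := by
  have hm : Measurable (fun t => F (t, blockSignal τ (t - c))) :=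
    hF.measurable.comp (measurable_id.prodMk
      ((blockSignal_measurable τ).comp (measurable_id.sub_const c)))
  obtain ⟨C, hC⟩ := ((isCompact_uIcc (a := a) (b := b)).prod
    (isCompact_Icc (a := (-1 : ℝ)) (b := 1))).exists_bound_of_continuousOn hF.continuousOn
  refine (intervalIntegrable_const (c := C)).mono_fun hm.aestronglyMeasurable ?_
  refine (MeasureTheory.ae_restrict_iff' measurableSet_uIoc).2 (Filter.Eventually.of_forall ?_)
  intro t ht
  have := hC (t, blockSignal τ (t - c)) ⟨Set.uIoc_subset_uIcc ht, blockSignal_mem _ _⟩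
  exact this.trans (le_abs_self C)

/-- Reflection: the primitive of an odd (about the midpoint) function is even. -/
theorem reflect_integral (f : ℝ → ℝ) (hf : ∀ a b, IntervalIntegrable f MeasureTheory.volume a b)
    (a b c m : ℝ) (hc : c = a + b)
    (h : ∀ t, a ≤ t → t ≤ b → t ≠ m → f (c - t) = -f t) :
    (a ≤ b → ∫ s in a..b, f s = 0) ∧
    (∀ t, a ≤ t → t ≤ b → ∫ s in a..(c - t), f s = ∫ s in a..t, f s) := by
  have key : ∀ t, a ≤ t → t ≤ b → ∫ s in a..(c - t), f s = -∫ s in t..b, f s := by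
    intro t hat htb
    have h1 : ∫ s in t..b, f (c - s) = ∫ s in (c - b)..(c - t), f s :=
      intervalIntegral.integral_comp_sub_left f c
    have h2 : c - b = a := by rw [hc]; ring
    rw [h2] at h1
    rw [← h1, ← intervalIntegral.integral_neg]
    apply intervalIntegral.integral_congr_ae
    have hne : ∀ᵐ s : ℝ, s ≠ m := by
      simp [MeasureTheory.ae_iff]
    filter_upwards [hne] with s hs hst
    rw [Set.uIoc_of_le htb] at hst
    exact h s (hat.trans hst.1.le) hst.2 hs
  have h0 : a ≤ b → ∫ s in a..b, f s = 0 := by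
    intro hab
    have := key a le_rfl hab
    have h2 : c - a = b := by rw [hc]; ring
    rw [h2] at this
    linarith
  refine ⟨h0, fun t hat htb => ?_⟩
  have h3 := intervalIntegral.integral_add_adjacent_intervals (hf a t) (hf t b)
  rw [key t hat htb]
  have := h0 (hat.trans htb)
  linarith

theorem block_odd_left (τ t : ℝ) (hτ : 0 < τ) (h0 : 0 ≤ t) (h1 : t ≤ 2 * τ) (hne : t ≠ τ) :
    blockSignal τ (2 * τ - t - 2 * τ) = -blockSignal τ (t - 2 * τ) := by
  unfold blockSignal
  rcases lt_or_gt_of_ne hne with h | h <;> split_ifs <;> first | linarith | norm_num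

theorem block_odd_right (τ t : ℝ) (hτ : 0 < τ) (h0 : 2 * τ ≤ t) (h1 : t ≤ 4 * τ)
    (hne : t ≠ 3 * τ) :
    blockSignal τ (6 * τ - t - 2 * τ) = -blockSignal τ (t - 2 * τ) := by
  unfold blockSignal
  rcases lt_or_gt_of_ne hne with h | h <;> split_ifs <;> first | linarith | norm_num

/-- inference: feeding the block-encoded input `P⁰(t) = û·Q(t−T/2)`
to the circuit implementation of the ANN, where layer `ℓ+1` (for `ℓ = 0,…,L−1`) has
fluxes `φ^ℓ(t)_{kj} = (φ₀^ℓ)_{kj} + ∫₀ᵗ P^ℓ_j` and outputs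
`P^{ℓ+1}(t)_k = σ(Σ_j W(φ^ℓ(t)_{kj}) P^ℓ(t)_j)`, we get:
(1) `φ^ℓ(0) = φ^ℓ(T/2) = φ^ℓ(T)` (non-invasiveness), and
(2) `P^L(T/2) = a^L`, the output of the ANN with weights `W(φ₀^ℓ)` at input `û`. -/
theorem inference_via_block_signal
    (L : ℕ) (hL : 1 ≤ L) (n : ℕ → ℕ) (hn : ∀ ℓ, 0 < n ℓ)
    (σ W : ℝ → ℝ) (hσc : Continuous σ) (hσodd : ∀ x, σ (-x) = -σ x)
    (hWc : Continuous W)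
    (τ T : ℝ) (hτ : 0 < τ) (hT : T = 4 * τ)
    (uhat : Fin (n 0) → ℝ)
    (φ₀ : (ℓ : ℕ) → Fin (n (ℓ + 1)) → Fin (n ℓ) → ℝ)
    (P : (ℓ : ℕ) → ℝ → Fin (n ℓ) → ℝ)
    (φ : (ℓ : ℕ) → ℝ → Fin (n (ℓ + 1)) → Fin (n ℓ) → ℝ)
    (hP0 : ∀ t j, P 0 t j = uhat j * blockSignal τ (t - T / 2))
    (hφ : ∀ ℓ, ℓ < L → ∀ t k j, φ ℓ t k j = φ₀ ℓ k j + ∫ s in (0:ℝ)..t, P ℓ s j)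
    (hP : ∀ ℓ, ℓ < L → ∀ t k, P (ℓ + 1) t k = σ (∑ j, W (φ ℓ t k j) * P ℓ t j))
    (a : (ℓ : ℕ) → Fin (n ℓ) → ℝ)
    (ha0 : ∀ j, a 0 j = uhat j)
    (ha : ∀ ℓ, ℓ < L → ∀ k, a (ℓ + 1) k = σ (∑ j, W (φ₀ ℓ k j) * a ℓ j)) :
    (∀ ℓ, ℓ < L → ∀ k j, φ ℓ 0 k j = φ ℓ (T / 2) k j ∧ φ ℓ (T / 2) k j = φ ℓ T k j) ∧
    (∀ k, P L (T / 2) k = a L k) := by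
  have hT2 : T / 2 = 2 * τ := by rw [hT]; ring
  rw [hT2] at hP0 ⊢
  rw [hT]
  -- consequences of the reflection symmetry for one layer
  have step : ∀ ℓ, ℓ < L →
      (∀ j, ∃ F : ℝ × ℝ → ℝ, Continuous F ∧
        ∀ t, P ℓ t j = F (t, blockSignal τ (t - 2 * τ))) →
      (∀ j t, 0 ≤ t → t ≤ 2 * τ → t ≠ τ → P ℓ (2 * τ - t) j = -P ℓ t j) →
      (∀ j t, 2 * τ ≤ t → t ≤ 4 * τ → t ≠ 3 * τ → P ℓ (6 * τ - t) j = -P ℓ t j) →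
      ∀ k j, Continuous (fun t => φ ℓ t k j) ∧ φ ℓ 0 k j = φ₀ ℓ k j ∧
        φ ℓ (2 * τ) k j = φ₀ ℓ k j ∧ φ ℓ (4 * τ) k j = φ₀ ℓ k j ∧
        (∀ t, 0 ≤ t → t ≤ 2 * τ → φ ℓ (2 * τ - t) k j = φ ℓ t k j) ∧
        (∀ t, 2 * τ ≤ t → t ≤ 4 * τ → φ ℓ (6 * τ - t) k j = φ ℓ t k j) := by
    intro ℓ hℓ hF hl hr k j
    obtain ⟨F, hFc, hFe⟩ := hF j
    have hint : ∀ a b, IntervalIntegrable (fun s => P ℓ s j) MeasureTheory.volume a b := by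
      intro a b
      have := block_integrable τ (2 * τ) F hFc a b
      simpa only [hFe] using this
    obtain ⟨l0, l1⟩ := reflect_integral (fun s => P ℓ s j) hint 0 (2 * τ) (2 * τ) τ (by ring)
      (hl j)
    obtain ⟨r0, r1⟩ := reflect_integral (fun s => P ℓ s j) hint (2 * τ) (4 * τ) (6 * τ) (3 * τ)
      (by ring) (hr j)
    have l0 := l0 (by linarith)
    have r0 := r0 (by linarith)
    have sp : ∀ t, φ ℓ t k j = φ₀ ℓ k j + ∫ s in (2 * τ)..t, P ℓ s j := by
      intro t
      rw [hφ ℓ hℓ, ← intervalIntegral.integral_add_adjacent_intervals (hint 0 (2 * τ))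
        (hint (2 * τ) t), l0, zero_add]
    refine ⟨?_, ?_, ?_, ?_, ?_, ?_⟩
    · simp only [hφ ℓ hℓ]
      exact continuous_const.add (intervalIntegral.continuous_primitive hint 0)
    · simp [hφ ℓ hℓ]
    · simp [sp]
    · rw [sp, r0, add_zero]
    · intro t h0 h1
      rw [hφ ℓ hℓ, hφ ℓ hℓ, l1 t h0 h1]
    · intro t h0 h1
      rw [sp, sp, r1 t h0 h1]
  have inv : ∀ ℓ, ℓ ≤ L →
      (∀ j, ∃ F : ℝ × ℝ → ℝ, Continuous F ∧
        ∀ t, P ℓ t j = F (t, blockSignal τ (t - 2 * τ))) ∧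
      (∀ j t, 0 ≤ t → t ≤ 2 * τ → t ≠ τ → P ℓ (2 * τ - t) j = -P ℓ t j) ∧
      (∀ j t, 2 * τ ≤ t → t ≤ 4 * τ → t ≠ 3 * τ → P ℓ (6 * τ - t) j = -P ℓ t j) ∧
      (∀ j, P ℓ (2 * τ) j = a ℓ j) := by
    intro ℓ
    induction ℓ with
    | zero =>
      intro _
      refine ⟨fun j => ⟨fun p => uhat j * p.2, by fun_prop, fun t => hP0 t j⟩, ?_, ?_, ?_⟩
      · intro j t h0 h1 hne
        rw [hP0, hP0, block_odd_left τ t hτ h0 h1 hne]; ring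
      · intro j t h0 h1 hne
        rw [hP0, hP0, block_odd_right τ t hτ h0 h1 hne]; ring
      · intro j
        have : blockSignal τ (2 * τ - 2 * τ) = 1 := by
          unfold blockSignal
          split_ifs <;> first | linarith | norm_num
        rw [hP0, ha0, this, mul_one]
    | succ ℓ ih =>
      intro hℓ
      have hℓ' : ℓ < L := hℓ
      obtain ⟨hF, hl, hr, hm⟩ := ih hℓ'.le
      have hs := step ℓ hℓ' hF hl hr
      refine ⟨?_, ?_, ?_, ?_⟩
      · intro k
        choose F hFc hFe using hF
        refine ⟨fun p => σ (∑ j, W (φ ℓ p.1 k j) * F j p), ?_, ?_⟩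
        · refine hσc.comp (continuous_finsetSum _ fun j _ => ?_)
          exact (hWc.comp ((hs k j).1.comp continuous_fst)).mul (hFc j)
        · intro t
          rw [hP ℓ hℓ']
          simp only [hFe]
      · intro k t h0 h1 hne
        rw [hP ℓ hℓ', hP ℓ hℓ', ← hσodd, ← Finset.sum_neg_distrib]
        congr 1
        refine Finset.sum_congr rfl fun j _ => ?_
        rw [(hs k j).2.2.2.2.1 t h0 h1, hl j t h0 h1 hne, mul_neg]
      · intro k t h0 h1 hne
        rw [hP ℓ hℓ', hP ℓ hℓ', ← hσodd, ← Finset.sum_neg_distrib]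
        congr 1
        refine Finset.sum_congr rfl fun j _ => ?_
        rw [(hs k j).2.2.2.2.2 t h0 h1, hr j t h0 h1 hne, mul_neg]
      · intro k
        rw [hP ℓ hℓ', ha ℓ hℓ']
        congr 1
        refine Finset.sum_congr rfl fun j _ => ?_
        rw [(hs k j).2.2.1, hm j]
  refine ⟨?_, (inv L le_rfl).2.2.2⟩
  intro ℓ hℓ k j
  obtain ⟨hF, hl, hr, _⟩ := inv ℓ hℓ.le
  obtain ⟨_, h0, h2, h4, _⟩ := step ℓ hℓ hF hl hr k j
  exact ⟨h0.trans h2.symm, h2.trans h4.symm⟩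
end

section
/- Let ℓ ≥ 1, let σ : ℝ → ℝ be continuous, odd and strictly increasing, let W : ℝ → ℝ be continuous with W(x) > 0 for all x ∈ ℝ, let τ > 0 and T = 4τ, and consider the path dynamics with input P⁰(t) = Q(t − T/2) and initial fluxes φ₀^1, …, φ₀^ℓ ∈ ℝ. Then P^κ(T/2) ≠ 0 for every κ ∈ {0, 1, …, ℓ−1}, and the initial memductance of the ℓ-th memristor is recovered from the midpoint current measurements as W(φ₀^ℓ) = J^ℓ(T/2) / P^{ℓ−1}(T/2); in particular, for ℓ ≥ 2 this equals J^ℓ(T/2) / σ(J^{ℓ−1}(T/2)), and for ℓ = 1 it equals J^1(T/2). -/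
open MeasureTheory in
/-- Facts about the signed block signal modulated by a continuous symmetric factor. -/
theorem aux_integrable (τ : ℝ) (g : ℝ → ℝ) (hg : Continuous g) (a b : ℝ) :
    IntervalIntegrable (fun s => g s * blockSignal τ (s - 2 * τ)) volume a b := by
  have hm : Measurable (fun s => blockSignal τ (s - 2 * τ)) := by
    unfold blockSignal
    have hs : Measurable (fun s : ℝ => s - 2 * τ) := by fun_prop
    refine Measurable.ite (measurableSet_lt hs measurable_const) measurable_const ?_
    refine Measurable.ite (measurableSet_lt hs measurable_const) measurable_const ?_
    refine Measurable.ite (measurableSet_le hs measurable_const) measurable_const ?_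
    exact Measurable.ite (measurableSet_le hs measurable_const) measurable_const measurable_const
  refine (hg.intervalIntegrable a b).mono_fun
    (hg.measurable.mul hm).aestronglyMeasurable (Filter.Eventually.of_forall fun s => ?_)
  have h1 : ‖blockSignal τ (s - 2 * τ)‖ ≤ 1 := by
    unfold blockSignal
    split_ifs <;> simp
  simp only [norm_mul]
  exact mul_le_of_le_one_right (norm_nonneg _) h1

theorem aux_anti (τ s : ℝ) (hs : s ∈ Set.Icc 0 (2 * τ)) (hne : s ≠ τ) :
    blockSignal τ ((2 * τ - s) - 2 * τ) = - blockSignal τ (s - 2 * τ) := by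
  obtain ⟨h0, h1⟩ := hs
  unfold blockSignal
  rcases lt_or_gt_of_ne hne with h | h
  · rw [if_neg (by linarith), if_neg (by linarith), if_pos (by linarith),
      if_neg (by linarith), if_pos (by linarith)]
    norm_num
  · rw [if_neg (by linarith), if_pos (by linarith),
      if_neg (by linarith), if_neg (by linarith), if_pos (by linarith)]

open MeasureTheory in
theorem aux_symm (τ : ℝ) (g : ℝ → ℝ) (hg : Continuous g)
    (hsym : ∀ t ∈ Set.Icc 0 (2 * τ), g (2 * τ - t) = g t) (t : ℝ)
    (ht : t ∈ Set.Icc 0 (2 * τ)) :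
    ∫ s in (0:ℝ)..(2 * τ - t), g s * blockSignal τ (s - 2 * τ) =
      ∫ s in (0:ℝ)..t, g s * blockSignal τ (s - 2 * τ) := by
  set p : ℝ → ℝ := fun s => g s * blockSignal τ (s - 2 * τ) with hp
  have hi := aux_integrable τ g hg
  have h1 : (∫ s in (0:ℝ)..(2 * τ - t), p s) - ∫ s in (0:ℝ)..t, p s
      = ∫ s in t..(2 * τ - t), p s :=
    intervalIntegral.integral_interval_sub_left (hi _ _) (hi _ _)
  have h2 : ∫ s in t..(2 * τ - t), p (2 * τ - s) = ∫ s in t..(2 * τ - t), p s := by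
    rw [intervalIntegral.integral_comp_sub_left (fun s => p s) (2 * τ)]
    congr 1
    ring
  have h3 : ∫ s in t..(2 * τ - t), p (2 * τ - s) = ∫ s in t..(2 * τ - t), - p s := by
    apply intervalIntegral.integral_congr_ae
    have hae : ∀ᵐ s : ℝ, s ≠ τ := by simp [ae_iff]
    filter_upwards [hae] with s hs hmem
    have hmem' : s ∈ Set.Icc 0 (2 * τ) := by
      obtain ⟨a, b⟩ := ht
      rw [Set.mem_uIoc] at hmem
      rcases hmem with ⟨c, d⟩ | ⟨c, d⟩ <;> constructor <;> linarith
    simp only [hp]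
    rw [aux_anti τ s hmem' hs, hsym s hmem']
    ring
  rw [intervalIntegral.integral_neg] at h3
  linarith

/-- for the path dynamics driven by the block input
`P⁰(t) = Q(t − T/2)` with `T = 4τ`, the midpoint voltages `P^κ(T/2)` are nonzero
for `κ ∈ {0,…,ℓ−1}`, and the initial memductance of the `ℓ`-th memristor is
recovered as `W(φ₀^ℓ) = J^ℓ(T/2) / P^{ℓ−1}(T/2)`; in particular, for `ℓ ≥ 2`
this equals `J^ℓ(T/2) / σ(J^{ℓ−1}(T/2))`, and for `ℓ = 1` it equals `J^1(T/2)`. -/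
theorem reading_memductance_formula (ℓ : ℕ) (hℓ : 1 ≤ ℓ)
    (σ W : ℝ → ℝ) (hσc : Continuous σ) (hσodd : ∀ x, σ (-x) = -σ x)
    (hσmono : StrictMono σ) (hWc : Continuous W) (hWpos : ∀ x, 0 < W x)
    (τ T : ℝ) (hτ : 0 < τ) (hT : T = 4 * τ)
    (φ₀ : ℕ → ℝ) (φ P J : ℕ → ℝ → ℝ)
    (hP0 : ∀ t, P 0 t = blockSignal τ (t - T / 2))
    (hφ : ∀ κ, 1 ≤ κ → κ ≤ ℓ → ∀ t, φ κ t = φ₀ κ + ∫ s in (0:ℝ)..t, P (κ - 1) s)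
    (hJ : ∀ κ, 1 ≤ κ → κ ≤ ℓ → ∀ t, J κ t = W (φ κ t) * P (κ - 1) t)
    (hPk : ∀ κ, 1 ≤ κ → κ ≤ ℓ → ∀ t, P κ t = σ (J κ t)) :
    (∀ κ, κ ≤ ℓ - 1 → P κ (T / 2) ≠ 0) ∧
    W (φ₀ ℓ) = J ℓ (T / 2) / P (ℓ - 1) (T / 2) ∧
    (2 ≤ ℓ → W (φ₀ ℓ) = J ℓ (T / 2) / σ (J (ℓ - 1) (T / 2))) ∧
    (ℓ = 1 → W (φ₀ 1) = J 1 (T / 2)) := by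
  subst hT
  have h22 : 4 * τ / 2 = 2 * τ := by ring
  simp only [h22] at hP0 ⊢
  have hσ0 : σ 0 = 0 := by
    have := hσodd 0
    rw [neg_zero] at this
    linarith
  have hone : blockSignal τ (2 * τ - 2 * τ) = 1 := by
    unfold blockSignal
    rw [if_neg (by linarith), if_neg (by linarith), if_pos (by linarith)]
  have hσb : ∀ x u, σ (x * blockSignal τ u) = σ x * blockSignal τ u := by
    intro x u
    unfold blockSignal
    split_ifs <;> simp [hσ0, hσodd]
  have hφs : ∀ κ, κ + 1 ≤ ℓ → ∀ g : ℝ → ℝ, Continuous g →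
      (∀ t ∈ Set.Icc 0 (2 * τ), g (2 * τ - t) = g t) →
      (∀ t, P κ t = g t * blockSignal τ (t - 2 * τ)) →
      Continuous (φ (κ + 1)) ∧
      (∀ t ∈ Set.Icc 0 (2 * τ), φ (κ + 1) (2 * τ - t) = φ (κ + 1) t) := by
    intro κ hκ g hg hsym hP
    have hPf : P κ = fun t => g t * blockSignal τ (t - 2 * τ) := funext hP
    have hf : φ (κ + 1) = fun t => φ₀ (κ + 1) +
        ∫ s in (0:ℝ)..t, g s * blockSignal τ (s - 2 * τ) := by
      funext t
      rw [hφ (κ + 1) (by omega) hκ t, Nat.add_sub_cancel, hPf]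
    rw [hf]
    refine ⟨continuous_const.add
      (intervalIntegral.continuous_primitive (aux_integrable τ g hg) 0), fun t ht => ?_⟩
    simp only
    rw [aux_symm τ g hg hsym t ht]
  have key : ∀ κ, κ ≤ ℓ → ∃ g : ℝ → ℝ, Continuous g ∧ (∀ t, 0 < g t) ∧
      (∀ t ∈ Set.Icc 0 (2 * τ), g (2 * τ - t) = g t) ∧
      (∀ t, P κ t = g t * blockSignal τ (t - 2 * τ)) := by
    intro κ
    induction κ with
    | zero =>
      intro _
      exact ⟨fun _ => 1, continuous_const, fun _ => one_pos, fun _ _ => rfl,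
        fun t => by rw [hP0, one_mul]⟩
    | succ κ ih =>
      intro hκ
      obtain ⟨g, hg, hpos, hsym, hP⟩ := ih (by omega)
      obtain ⟨hc, hs⟩ := hφs κ hκ g hg hsym hP
      refine ⟨fun t => σ (W (φ (κ + 1) t) * g t), hσc.comp ((hWc.comp hc).mul hg),
        fun t => ?_, fun t ht => ?_, fun t => ?_⟩
      · have := hσmono (mul_pos (hWpos (φ (κ + 1) t)) (hpos t))
        rwa [hσ0] at this
      · simp only
        rw [hs t ht, hsym t ht]
      · rw [hPk (κ + 1) (by omega) hκ, hJ (κ + 1) (by omega) hκ, Nat.add_sub_cancel, hP,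
          ← mul_assoc, hσb]
  have hne : ∀ κ, κ ≤ ℓ - 1 → P κ (2 * τ) ≠ 0 := by
    intro κ hκ
    obtain ⟨g, -, hpos, -, hP⟩ := key κ (by omega)
    rw [hP, hone, mul_one]
    exact (hpos _).ne'
  have hmain : W (φ₀ ℓ) = J ℓ (2 * τ) / P (ℓ - 1) (2 * τ) := by
    obtain ⟨m, rfl⟩ : ∃ m, ℓ = m + 1 := ⟨ℓ - 1, by omega⟩
    obtain ⟨g, hg, hpos, hsym, hP⟩ := key m (by omega)
    obtain ⟨-, hs⟩ := hφs m le_rfl g hg hsym hP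
    have h0 := hs 0 ⟨le_rfl, by linarith⟩
    rw [sub_zero, hφ (m + 1) hℓ le_rfl 0, intervalIntegral.integral_same, add_zero] at h0
    rw [hJ (m + 1) hℓ le_rfl, h0, mul_div_cancel_right₀ _ (hne _ le_rfl)]
  refine ⟨hne, hmain, fun h2 => ?_, fun h1 => ?_⟩
  · rw [← hPk (ℓ - 1) (by omega) (by omega)]
    exact hmain
  · subst h1
    rw [hmain, Nat.sub_self, hP0, hone, div_one]
end
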